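/- arXiv:2004.09243 — 2 statements merged into one kernel-verified Lean document; each statement's English description precedes it below -/
import Mathlib

section
/- Let (X, d) be a complete metric space endowed with a Borel measure μ for which there exists a constant c ≥ 1 such that 0 < μ(B(x, 2r)) ≤ c · μ(B(x, r)) < ∞ for every x ∈ X and every r > 0 (doubling property). Then X is a proper metric space, i.e., every closed and bounded subset of X is compact. -/
open Metric MeasureTheory
open scoped ENNReal

/-- Iterating a doubling inequality `k` times. -/
theorem measure_ball_two_pow_mul_le {X : Type*} [PseudoMetricSpace X] [MeasurableSpace X]
    {μ : Measure X} {c : ℝ≥0∞}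
    (h : ∀ (x : X) (r : ℝ), 0 < r → μ (ball x (2 * r)) ≤ c * μ (ball x r))
    (x : X) {r : ℝ} (hr : 0 < r) (k : ℕ) :
    μ (ball x (2 ^ k * r)) ≤ c ^ k * μ (ball x r) := by
  induction k with
  | zero => simp
  | succ k ih =>
    calc μ (ball x (2 ^ (k + 1) * r)) = μ (ball x (2 * (2 ^ k * r))) := by
          rw [pow_succ', mul_assoc]
      _ ≤ c * μ (ball x (2 ^ k * r)) := h x _ (by positivity)
      _ ≤ c * (c ^ k * μ (ball x r)) := by gcongr
      _ = c ^ (k + 1) * μ (ball x r) := by rw [pow_succ', mul_assoc]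

/-- A set that is not totally bounded contains an infinite uniformly separated sequence. -/
theorem exists_seq_le_dist_of_not_totallyBounded {X : Type*} [PseudoMetricSpace X] {s : Set X}
    (hs : ¬ TotallyBounded s) :
    ∃ ε > 0, ∃ u : ℕ → X, (∀ n, u n ∈ s) ∧ Pairwise fun m n => ε ≤ dist (u m) (u n) := by
  simp only [Metric.totallyBounded_iff, not_forall, not_exists, not_and] at hs
  obtain ⟨ε, hε, hs⟩ := hs
  have key : ∀ t : Set X, t.Finite → ∃ a, a ∈ s ∧ ∀ y ∈ t, ε ≤ dist a y := by
    intro t ht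
    obtain ⟨a, ha, hat⟩ := Set.not_subset.1 (hs t ht)
    exact ⟨a, ha, by simpa using hat⟩
  obtain ⟨u, hu⟩ := Set.seq_of_forall_finite_exists key
  refine ⟨ε, hε, u, fun n => (hu n).1, fun m n hmn => ?_⟩
  rcases hmn.lt_or_gt with h | h
  · rw [dist_comm]
    exact (hu n).2 _ ⟨m, h, rfl⟩
  · exact (hu m).2 _ ⟨n, h, rfl⟩

/-- A complete metric space endowed with a Borel measure satisfying the doubling
property `0 < μ(B(x, 2r)) ≤ c · μ(B(x, r)) < ∞` for some constant `c ≥ 1` is proper,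
i.e. all closed and bounded subsets are compact. -/
theorem doubling_implies_proper
    {X : Type*} [MetricSpace X] [CompleteSpace X]
    [MeasurableSpace X] [BorelSpace X] (μ : Measure X)
    (c : ℝ≥0∞) (hc : 1 ≤ c)
    (hdouble : ∀ (x : X) (r : ℝ), 0 < r →
      0 < μ (ball x (2 * r)) ∧
      μ (ball x (2 * r)) ≤ c * μ (ball x r) ∧
      c * μ (ball x r) < ∞) :
    ProperSpace X := by
  have hpos : ∀ (x : X) (r : ℝ), 0 < r → 0 < μ (ball x r) := fun x r hr => by
    simpa [mul_div_cancel₀] using (hdouble x (r / 2) (by positivity)).1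
  have hfin : ∀ (x : X) (r : ℝ), 0 < r → μ (ball x r) < ∞ := fun x r hr =>
    (le_mul_of_one_le_left' hc).trans_lt (hdouble x r hr).2.2
  refine ⟨fun x R => isCompact_iff_totallyBounded_isComplete.2
    ⟨?_, isClosed_closedBall.isComplete⟩⟩
  by_contra hR
  obtain ⟨ε, hε, u, hu, hsep⟩ := exists_seq_le_dist_of_not_totallyBounded hR
  have hR0 : 0 ≤ R := dist_nonneg.trans (mem_closedBall.1 (hu 0))
  have hc_top : c ≠ ∞ := by
    rintro rfl
    have h := (hdouble x 1 one_pos).2.2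
    rw [ENNReal.top_mul (hpos x 1 one_pos).ne'] at h
    exact h.false
  obtain ⟨k, hk⟩ := pow_unbounded_of_one_lt ((2 * R + ε) / (ε / 2)) one_lt_two
  rw [div_lt_iff₀ (by positivity)] at hk
  have hlow : ∀ n, μ (ball x (R + ε)) / c ^ k ≤ μ (ball (u n) (ε / 2)) := fun n =>
    ENNReal.div_le_of_le_mul' <| calc
      μ (ball x (R + ε)) ≤ μ (ball (u n) (2 ^ k * (ε / 2))) := by
        refine measure_mono (ball_subset_ball' ?_)
        have := mem_closedBall'.1 (hu n)
        linarith
      _ ≤ c ^ k * μ (ball (u n) (ε / 2)) :=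
        measure_ball_two_pow_mul_le (fun y r hr => (hdouble y r hr).2.1) _ (by positivity) k
  have hdisj : Pairwise (Function.onFun Disjoint fun n => ball (u n) (ε / 2)) := fun m n hmn =>
    ball_disjoint_ball (by linarith [hsep hmn])
  have hsub : (⋃ n, ball (u n) (ε / 2)) ⊆ ball x (R + ε) :=
    Set.iUnion_subset fun n => ball_subset_ball' (by linarith [mem_closedBall.1 (hu n)])
  have hfinite := Measure.finite_const_le_meas_of_disjoint_iUnion μ
    (ENNReal.div_pos (hpos x (R + ε) (by positivity)).ne' (ENNReal.pow_ne_top (n := k) hc_top))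
    (fun n => measurableSet_ball) hdisj
    ((measure_mono hsub).trans_lt (hfin x (R + ε) (by positivity))).ne
  exact Set.infinite_univ (hfinite.subset fun n _ => hlow n)
end

section
/- Let X be a Banach space, T > 0, h > 0, v₀ ∈ X, 1 ≤ r < ∞, and let v : (0,T) → X be strongly measurable with ∫₀ᵀ ‖v(t)‖_X^r dt < ∞. Then for every t₀ ∈ (0,T] the time-mollification satisfies (∫₀^{t₀} ‖[v]_h(t)‖_X^r dt)^{1/r} ≤ (∫₀^{t₀} ‖v(t)‖_X^r dt)^{1/r} + [ (h/r)(1 − e^{−t₀ r/h}) ]^{1/r} ‖v₀‖_X. -/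
open MeasureTheory Set

/-- The time-mollification `[v]_h(t) = e^{-t/h} v₀ + (1/h) ∫₀ᵗ e^{(s-t)/h} v(s) ds`. -/
noncomputable def timeMoll {X : Type*} [NormedAddCommGroup X] [NormedSpace ℝ X]
    (h : ℝ) (v₀ : X) (v : ℝ → X) (t : ℝ) : X :=
  Real.exp (-t / h) • v₀ + (1 / h) • ∫ s in (0:ℝ)..t, Real.exp ((s - t) / h) • v s

open ProbabilityTheory
open scoped ENNReal

/-- Jensen's inequality for the `r`-th power against a probability density. -/
lemma lintegral_mul_rpow_le_of_lintegral_eq_one {α : Type*} [MeasurableSpace α] {μ : Measure α}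
    {k f : α → ℝ≥0∞} (hk : Measurable k) (hf : Measurable f) (hk1 : ∫⁻ a, k a ∂μ = 1)
    {r : ℝ} (hr : 1 ≤ r) :
    (∫⁻ a, k a * f a ∂μ) ^ r ≤ ∫⁻ a, k a * f a ^ r ∂μ := by
  have hr0 : 0 < r := zero_lt_one.trans_le hr
  have : IsProbabilityMeasure (μ.withDensity k) := ⟨by simpa using hk1⟩
  have key := eLpNorm'_le_eLpNorm'_of_exponent_le one_pos hr (μ.withDensity k)
    hf.aestronglyMeasurable
  simp only [eLpNorm'_eq_lintegral_enorm, enorm_eq_self, ENNReal.rpow_one, div_one] at key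
  rw [one_div, ENNReal.le_rpow_inv_iff hr0,
    lintegral_withDensity_eq_lintegral_mul _ hk hf,
    lintegral_withDensity_eq_lintegral_mul _ hk (hf.pow_const r)] at key
  exact key

/-- Young's inequality for the convolution of an `L^r` function with a probability density. -/
lemma lintegral_lintegral_sub_mul_rpow_le {k f : ℝ → ℝ≥0∞} (hk : Measurable k)
    (hf : Measurable f) (hk1 : ∫⁻ u, k u = 1) {r : ℝ} (hr : 1 ≤ r) :
    ∫⁻ t, (∫⁻ s, k (t - s) * f s) ^ r ≤ ∫⁻ s, f s ^ r := by
  calc ∫⁻ t, (∫⁻ s, k (t - s) * f s) ^ r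
      ≤ ∫⁻ t, ∫⁻ s, k (t - s) * f s ^ r := by
        refine lintegral_mono fun t => ?_
        refine lintegral_mul_rpow_le_of_lintegral_eq_one (by fun_prop) hf ?_ hr
        rw [lintegral_sub_left_eq_self k t, hk1]
    _ = ∫⁻ s, ∫⁻ t, k (t - s) * f s ^ r :=
        lintegral_lintegral_swap (by unfold Function.uncurry; fun_prop)
    _ = ∫⁻ s, f s ^ r := by
        refine lintegral_congr fun s => ?_
        rw [lintegral_mul_const _ (by fun_prop), lintegral_sub_right_eq_self k s, hk1, one_mul]

lemma measurable_exponentialPDF (a : ℝ) : Measurable (exponentialPDF a) :=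
  (measurable_exponentialPDFReal a).ennreal_ofReal

/-- The time-mollification is dominated by the decay of the initial value plus the convolution
with an exponential density. -/
lemma enorm_timeMoll_le {X : Type*} [NormedAddCommGroup X] [NormedSpace ℝ X]
    {h t : ℝ} (hh : 0 < h) (ht : 0 ≤ t) (v₀ : X) (v : ℝ → X) :
    ‖timeMoll h v₀ v t‖ₑ ≤ ENNReal.ofReal (Real.exp (-t / h)) * ‖v₀‖ₑ +
      ∫⁻ s in Ioc 0 t, exponentialPDF (1 / h) (t - s) * ‖v s‖ₑ := by
  have hh' : 0 ≤ 1 / h := by positivity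
  refine (enorm_add_le _ _).trans (add_le_add ?_ ?_)
  · rw [enorm_smul, Real.enorm_of_nonneg (Real.exp_pos _).le]
  · rw [enorm_smul, Real.enorm_of_nonneg hh', intervalIntegral.integral_of_le ht]
    calc _ ≤ ENNReal.ofReal (1 / h) * ∫⁻ s in Ioc 0 t, ‖Real.exp ((s - t) / h) • v s‖ₑ := by
          gcongr; exact enorm_integral_le_lintegral_enorm _
      _ = ∫⁻ s in Ioc 0 t, ENNReal.ofReal (1 / h) * ‖Real.exp ((s - t) / h) • v s‖ₑ :=
          (lintegral_const_mul' _ _ ENNReal.ofReal_ne_top).symm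
      _ = _ := by
          refine setLIntegral_congr_fun measurableSet_Ioc fun s hs => ?_
          rw [exponentialPDF_of_nonneg (sub_nonneg.2 hs.2), enorm_smul,
            Real.enorm_of_nonneg (Real.exp_pos _).le, ENNReal.ofReal_mul hh', mul_assoc]
          congr 4
          ring

lemma lintegral_exp_neg_div_mul_rpow {h r t₀ : ℝ} (hh : 0 < h) (hr : 0 < r) (ht₀ : 0 ≤ t₀)
    (c : ℝ≥0∞) :
    ∫⁻ t in Ioc 0 t₀, (ENNReal.ofReal (Real.exp (-t / h)) * c) ^ r =
      ENNReal.ofReal (h / r * (1 - Real.exp (-(t₀ * r) / h))) * c ^ r := by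
  have hexp (t : ℝ) : (ENNReal.ofReal (Real.exp (-t / h)) * c) ^ r =
      ENNReal.ofReal (Real.exp (-(t * r) / h)) * c ^ r := by
    rw [ENNReal.mul_rpow_of_nonneg _ _ hr.le,
      ENNReal.ofReal_rpow_of_nonneg (Real.exp_pos _).le hr.le, ← Real.exp_mul]
    congr 3
    ring
  have hcont : Continuous fun t : ℝ => Real.exp (-(t * r) / h) := by fun_prop
  simp only [hexp]
  rw [lintegral_mul_const _ (by fun_prop), ← ofReal_integral_eq_lintegral_ofReal
    (hcont.integrableOn_Ioc) (.of_forall fun t => (Real.exp_pos _).le),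
    ← intervalIntegral.integral_of_le ht₀]
  congr 2
  have hderiv (t : ℝ) : HasDerivAt (fun t => -(h / r) * Real.exp (-(t * r) / h))
      (Real.exp (-(t * r) / h)) t := by
    have := ((hasDerivAt_mul_const r).fun_neg.div_const h).exp.const_mul (-(h / r)) (x := t)
    refine this.congr_deriv ?_
    field_simp
  rw [intervalIntegral.integral_eq_sub_of_hasDerivAt (fun t _ => hderiv t)
    (hcont.intervalIntegrable _ _)]
  simp
  ring

/-- The `L^r` bound for the time-mollification: for `1 ≤ r < ∞` and any `t₀ ∈ (0,T]`,
`‖[v]_h‖_{L^r(0,t₀;X)} ≤ ‖v‖_{L^r(0,t₀;X)} + [(h/r)(1 - e^{-t₀ r/h})]^{1/r} ‖v₀‖_X`. -/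
theorem timeMoll_Lr_bound
    {X : Type*} [NormedAddCommGroup X] [NormedSpace ℝ X] [CompleteSpace X]
    (T h : ℝ) (hT : 0 < T) (hh : 0 < h) (v₀ : X) (v : ℝ → X)
    (r : ℝ) (hr : 1 ≤ r)
    (hmeas : AEStronglyMeasurable v (volume.restrict (Ioo 0 T)))
    (hint : IntegrableOn (fun t => ‖v t‖ ^ r) (Ioo 0 T)) :
    ∀ t₀ ∈ Ioc 0 T,
      (∫ t in (0:ℝ)..t₀, ‖timeMoll h v₀ v t‖ ^ r) ^ (1 / r) ≤
        (∫ t in (0:ℝ)..t₀, ‖v t‖ ^ r) ^ (1 / r) +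
          ((h / r) * (1 - Real.exp (-(t₀ * r) / h))) ^ (1 / r) * ‖v₀‖ := by
  intro t₀ ht₀
  have hr0 : 0 < r := zero_lt_one.trans_le hr
  have hr' : 0 ≤ 1 / r := by positivity
  have hsub : volume.restrict (Ioc 0 t₀) ≤ volume.restrict (Ioo 0 T) := by
    rw [restrict_Ioo_eq_restrict_Ioc]
    exact Measure.restrict_mono (Ioc_subset_Ioc_right ht₀.2) le_rfl
  have hm := hmeas.mono_measure hsub
  have hi : IntegrableOn (fun t => ‖v t‖ ^ r) (Ioc 0 t₀) := Integrable.mono_measure hint hsub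
  have hnorm (x : X) : ENNReal.ofReal (‖x‖ ^ r) = ‖x‖ₑ ^ r := by
    rw [← ENNReal.ofReal_rpow_of_nonneg (norm_nonneg x) hr0.le, ofReal_norm]
  set f : ℝ → ℝ≥0∞ := (Ioc 0 t₀).indicator fun s => ‖hm.mk v s‖ₑ with hf_def
  have hf : Measurable f := hm.stronglyMeasurable_mk.enorm.indicator measurableSet_Ioc
  have hvf : ∀ᵐ s ∂volume.restrict (Ioc 0 t₀), ‖v s‖ₑ = f s := by
    filter_upwards [hm.ae_eq_mk, ae_restrict_mem measurableSet_Ioc] with s hs hs'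
    rw [hf_def, indicator_of_mem hs', hs]
  set k := exponentialPDF (1 / h) with hk_def
  have hk : Measurable k := measurable_exponentialPDF _
  have hk1 : ∫⁻ u, k u = 1 := lintegral_exponentialPDF_eq_one (by positivity)
  set A : ℝ → ℝ≥0∞ := fun t => ENNReal.ofReal (Real.exp (-t / h)) * ‖v₀‖ₑ with hA_def
  set G : ℝ → ℝ≥0∞ := fun t => ∫⁻ s, k (t - s) * f s with hG_def
  have hA : Measurable A := by fun_prop
  have hG : Measurable G := by
    refine Measurable.lintegral_prod_right' (f := fun p : ℝ × ℝ => k (p.1 - p.2) * f p.2) ?_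
    fun_prop
  have hpt : ∀ t ∈ Ioc 0 t₀, ‖timeMoll h v₀ v t‖ₑ ≤ (A + G) t := by
    intro t ht
    refine (enorm_timeMoll_le hh ht.1.le v₀ v).trans (add_le_add le_rfl ?_)
    calc ∫⁻ s in Ioc 0 t, k (t - s) * ‖v s‖ₑ = ∫⁻ s in Ioc 0 t, k (t - s) * f s := by
          refine lintegral_congr_ae ?_
          filter_upwards [ae_restrict_of_ae_restrict_of_subset
            (Ioc_subset_Ioc_right ht.2) hvf] with s hs
          rw [hs]
      _ ≤ G t := setLIntegral_le_lintegral _ _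
  have hGf : ∫⁻ t in Ioc 0 t₀, G t ^ r ≤ ENNReal.ofReal (∫ t in (0:ℝ)..t₀, ‖v t‖ ^ r) :=
    calc ∫⁻ t in Ioc 0 t₀, G t ^ r ≤ ∫⁻ t, G t ^ r := setLIntegral_le_lintegral _ _
      _ ≤ ∫⁻ s, f s ^ r := lintegral_lintegral_sub_mul_rpow_le hk hf hk1 hr
      _ = ∫⁻ s in Ioc 0 t₀, f s ^ r := by
          refine (setLIntegral_eq_of_support_subset fun s hs => ?_).symm
          by_contra hs'
          exact hs (by simp [hf_def, indicator_of_notMem hs', hr0])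
      _ = ∫⁻ s in Ioc 0 t₀, ENNReal.ofReal (‖v s‖ ^ r) := by
          refine lintegral_congr_ae ?_
          filter_upwards [hvf] with s hs
          rw [hnorm, hs]
      _ = _ := by
          rw [intervalIntegral.integral_of_le ht₀.1.le, ofReal_integral_eq_lintegral_ofReal hi
            (.of_forall fun t => by positivity)]
  have hL : ENNReal.ofReal (∫ t in (0:ℝ)..t₀, ‖timeMoll h v₀ v t‖ ^ r) ≤
      ∫⁻ t in Ioc 0 t₀, (A + G) t ^ r := by
    rw [intervalIntegral.integral_of_le ht₀.1.le]
    refine (Real.ofReal_le_enorm _).trans ((enorm_integral_le_lintegral_enorm _).trans ?_)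
    refine setLIntegral_mono' measurableSet_Ioc fun t ht => ?_
    rw [Real.enorm_of_nonneg (by positivity), hnorm]
    gcongr
    exact hpt t ht
  have hLnn : 0 ≤ ∫ t in (0:ℝ)..t₀, ‖timeMoll h v₀ v t‖ ^ r :=
    intervalIntegral.integral_nonneg ht₀.1.le fun t _ => by positivity
  have hvnn : 0 ≤ ∫ t in (0:ℝ)..t₀, ‖v t‖ ^ r :=
    intervalIntegral.integral_nonneg ht₀.1.le fun t _ => by positivity
  have hcnn : 0 ≤ h / r * (1 - Real.exp (-(t₀ * r) / h)) := by
    refine mul_nonneg (by positivity) (sub_nonneg.2 (Real.exp_le_one_iff.2 ?_))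
    exact div_nonpos_of_nonpos_of_nonneg (neg_nonpos.2 (mul_nonneg ht₀.1.le hr0.le)) hh.le
  rw [← ENNReal.ofReal_le_ofReal_iff (by positivity), ENNReal.ofReal_add (by positivity)
    (by positivity), ENNReal.ofReal_mul (by positivity),
    ← ENNReal.ofReal_rpow_of_nonneg hLnn hr', ← ENNReal.ofReal_rpow_of_nonneg hvnn hr',
    ← ENNReal.ofReal_rpow_of_nonneg hcnn hr', ofReal_norm]
  calc _ ≤ (∫⁻ t in Ioc 0 t₀, (A + G) t ^ r) ^ (1 / r) := by gcongr
    _ ≤ (∫⁻ t in Ioc 0 t₀, A t ^ r) ^ (1 / r) + (∫⁻ t in Ioc 0 t₀, G t ^ r) ^ (1 / r) :=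
        ENNReal.lintegral_Lp_add_le hA.aemeasurable hG.aemeasurable hr
    _ ≤ _ := by
        rw [add_comm, lintegral_exp_neg_div_mul_rpow hh hr0 ht₀.1.le,
          ENNReal.mul_rpow_of_nonneg _ _ hr', ← ENNReal.rpow_mul, mul_one_div_cancel hr0.ne',
          ENNReal.rpow_one]
        gcongr
end
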